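/- arXiv:2306.09929 — 3 statements merged into one kernel-verified Lean document; each statement's English description precedes it below -/
import Mathlib

section
/- Let D > 0 and let Y ⊆ [−D, D] be a Lebesgue-measurable set which is symmetric (y ∈ Y if and only if −y ∈ Y), contains 0, and has positive Lebesgue measure λ(Y). Then for every integer ℓ ≥ ⌊12D/λ(Y)⌋, the ℓ-fold iterated sumset ℓY := {y₁ + ⋯ + y_ℓ : y₁, …, y_ℓ ∈ Y} contains the interval [−D, D]. -/
open Filter Finset MeasureTheory

/-- The points of `I` reachable from `0` by `n` steps in `Y` that never leave `I`. -/
def reachSet (Y I : Set ℝ) : ℕ → Set ℝ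
  | 0 => {0}
  | n + 1 => {x | x ∈ I ∧ ∃ p ∈ reachSet Y I n, ∃ y ∈ Y, p + y = x}

section reachSet

variable {Y I : Set ℝ}

lemma reachSet_subset (hI : (0 : ℝ) ∈ I) (n : ℕ) : reachSet Y I n ⊆ I := by
  cases n with
  | zero => rintro x rfl; exact hI
  | succ n => exact fun x hx => hx.1

lemma monotone_reachSet (hI : (0 : ℝ) ∈ I) (hY : (0 : ℝ) ∈ Y) : Monotone (reachSet Y I) :=
  monotone_nat_of_le_succ fun n x hx =>
    ⟨reachSet_subset hI n hx, x, hx, 0, hY, add_zero x⟩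

lemma exists_sum_eq_of_mem_reachSet (n : ℕ) {x : ℝ} (hx : x ∈ reachSet Y I n) :
    ∃ y : Fin n → ℝ, (∀ i, y i ∈ Y) ∧ ∑ i, y i = x := by
  induction n generalizing x with
  | zero =>
    obtain rfl : x = 0 := hx
    exact ⟨fun _ => 0, fun i => i.elim0, by simp⟩
  | succ n ih =>
    obtain ⟨-, p, hp, a, ha, rfl⟩ := hx
    obtain ⟨y, hy, rfl⟩ := ih hp
    refine ⟨Fin.cons a y, fun i => ?_, ?_⟩
    · refine Fin.cases ?_ (fun j => ?_) i
      · simpa using ha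
      · simpa using hy j
    · rw [Fin.sum_cons, add_comm]

/-- Once two consecutive reachable sets agree, the sequence is constant. -/
lemma reachSet_subset_of_succ_subset (hI : (0 : ℝ) ∈ I) (hY : (0 : ℝ) ∈ Y) {n : ℕ}
    (h : reachSet Y I (n + 1) ⊆ reachSet Y I n) (m : ℕ) :
    reachSet Y I m ⊆ reachSet Y I n := by
  induction m with
  | zero => exact monotone_reachSet hI hY (Nat.zero_le n)
  | succ m ih =>
    rintro x ⟨hx, p, hp, y, hy, rfl⟩
    exact h ⟨hx, p, ih hp, y, hy, rfl⟩

/-- If the reachable sets are not exhausted before step `k`, each step up to `k` reaches a point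
that the earlier steps do not. -/
lemma exists_mem_reachSet_notMem_lt (hI : (0 : ℝ) ∈ I) (hY : (0 : ℝ) ∈ Y) {k : ℕ} {z : ℝ}
    (hz : z ∈ reachSet Y I k) (hmin : ∀ m < k, z ∉ reachSet Y I m) {n : ℕ} (hn : n ≤ k) :
    ∃ x ∈ reachSet Y I n, ∀ m < n, x ∉ reachSet Y I m := by
  cases n with
  | zero => exact ⟨0, rfl, by simp⟩
  | succ n =>
    have h : ¬ reachSet Y I (n + 1) ⊆ reachSet Y I n := fun h =>
      hmin n hn (reachSet_subset_of_succ_subset hI hY h k hz)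
    obtain ⟨x, hx, hxn⟩ := Set.not_subset.1 h
    exact ⟨x, hx, fun m hm hxm => hxn (monotone_reachSet hI hY (Nat.le_of_lt_succ hm) hxm)⟩

end reachSet

section Interval

variable {D : ℝ} {Y : Set ℝ}

/-- Two steps of length at most `D` between points of `[-D, D]` can be ordered so that the
intermediate point also lies in `[-D, D]`. -/
lemma add_add_mem_reachSet (hD : 0 < D) (hYsub : Y ⊆ Set.Icc (-D) D) {n : ℕ} {x a b : ℝ}
    (hx : x ∈ reachSet Y (Set.Icc (-D) D) n) (ha : a ∈ Y) (hb : b ∈ Y)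
    (hmem : x + a + b ∈ Set.Icc (-D) D) :
    x + a + b ∈ reachSet Y (Set.Icc (-D) D) (n + 2) := by
  have hxI := reachSet_subset (by simp [hD.le]) n hx
  have haI := hYsub ha
  have hbI := hYsub hb
  have key : x + a ∈ Set.Icc (-D) D ∨ x + b ∈ Set.Icc (-D) D := by
    simp only [Set.mem_Icc] at *
    grind
  rcases key with h | h
  · exact ⟨hmem, x + a, ⟨h, x, hx, a, ha, rfl⟩, b, hb, rfl⟩
  · exact ⟨hmem, x + b, ⟨h, x, hx, b, hb, rfl⟩, a, ha, by ring⟩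

lemma exists_mem_reachSet (hD : 0 < D) (hYmeas : MeasurableSet Y)
    (hYsub : Y ⊆ Set.Icc (-D) D) (hYsym : ∀ y : ℝ, y ∈ Y ↔ -y ∈ Y) (hYpos : 0 < volume Y)
    {z : ℝ} (hz : z ∈ Set.Icc (-D) D) : ∃ n, z ∈ reachSet Y (Set.Icc (-D) D) n := by
  obtain ⟨ε, hε, hball⟩ := Metric.mem_nhds_iff.1
    (Measure.sub_mem_nhds_zero_of_addHaar_pos volume Y hYmeas hYpos)
  obtain ⟨N, hN⟩ := exists_nat_gt (|z| / ε)
  have hN0 : (0 : ℝ) < N := (by positivity : (0 : ℝ) ≤ |z| / ε).trans_lt hN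
  have hstep : z / N ∈ Metric.ball (0 : ℝ) ε := by
    rw [mem_ball_zero_iff, Real.norm_eq_abs, abs_div, abs_of_pos hN0, div_lt_iff₀ hN0]
    rw [div_lt_iff₀ hε] at hN
    linarith
  obtain ⟨a, ha, b, hb, hab⟩ := hball hstep
  have key : ∀ j ≤ N, j * (z / N) ∈ reachSet Y (Set.Icc (-D) D) (2 * j) := by
    intro j
    induction j with
    | zero => intro _; simp [reachSet]
    | succ j ih =>
      intro hj
      have hmem : ((j + 1 : ℕ) : ℝ) * (z / N) ∈ Set.Icc (-D) D := by
        have h1 : ((j + 1 : ℕ) : ℝ) / N ≤ 1 := by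
          rw [div_le_one hN0]; exact_mod_cast hj
        rw [Set.mem_Icc, ← abs_le] at hz ⊢
        calc |((j + 1 : ℕ) : ℝ) * (z / N)| = ((j + 1 : ℕ) : ℝ) / N * |z| := by
              rw [abs_mul, abs_div, abs_of_pos hN0, Nat.abs_cast]; ring
          _ ≤ 1 * |z| := by gcongr
          _ ≤ D := by rwa [one_mul]
      have heq : ((j + 1 : ℕ) : ℝ) * (z / N) = j * (z / N) + a + -b := by
        have : a - b = z / N := hab
        push_cast
        linarith
      rw [heq] at hmem ⊢
      exact add_add_mem_reachSet hD hYsub (ih (by omega)) ha ((hYsym b).1 hb) hmem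
  refine ⟨2 * N, ?_⟩
  have h := key N le_rfl
  rwa [mul_div_cancel₀ z hN0.ne'] at h

/-- Disjoint translates of `Y` by points of `[-D, D]` all fit inside `[-2D, 2D]`. -/
lemma card_mul_volume_le_of_pairwiseDisjoint {ι : Type*} (hD : 0 < D) (hYmeas : MeasurableSet Y)
    (hYsub : Y ⊆ Set.Icc (-D) D) (s : Finset ι) (t : ι → ℝ)
    (ht : ∀ i ∈ s, t i ∈ Set.Icc (-D) D)
    (hdisj : (s : Set ι).PairwiseDisjoint fun i => (fun x => t i + x) '' Y) :
    #s * (volume Y).toReal ≤ 4 * D := by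
  have hsub : (⋃ i ∈ s, (fun x => t i + x) '' Y) ⊆ Set.Icc (-(2 * D)) (2 * D) := by
    refine Set.iUnion₂_subset fun i hi => ?_
    rintro _ ⟨y, hy, rfl⟩
    have h1 := ht i hi
    have h2 := hYsub hy
    simp only [Set.mem_Icc] at *
    constructor <;> linarith
  have hle := measure_mono (μ := volume) hsub
  rw [measure_biUnion_finset hdisj
    fun i _ => (MeasurableEquiv.addLeft (t i)).measurableSet_image.2 hYmeas] at hle
  simp only [Set.image_add_left, measure_preimage_add, sum_const, nsmul_eq_mul,
    Real.volume_Icc] at hle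
  have h := ENNReal.toReal_mono ENNReal.ofReal_ne_top hle
  rw [ENNReal.toReal_mul, ENNReal.toReal_natCast, ENNReal.toReal_ofReal (by linarith)] at h
  linarith

end Interval

open Filter Finset MeasureTheory

/-- **Lemma 3.5.** If `Y ⊆ [-D, D]` is a symmetric measurable set containing `0` with
positive Lebesgue measure, then for every `ℓ ≥ ⌊12D/λ(Y)⌋` the `ℓ`-fold sumset `ℓY`
contains `[-D, D]`. -/
theorem iterated_sumset_covers_interval
    (D : ℝ) (hD : 0 < D) (Y : Set ℝ) (hYmeas : MeasurableSet Y)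
    (hYsub : Y ⊆ Set.Icc (-D) D) (hYsym : ∀ y : ℝ, y ∈ Y ↔ -y ∈ Y) (hY0 : (0 : ℝ) ∈ Y)
    (hYpos : 0 < volume Y)
    (ℓ : ℕ) (hℓ : ⌊12 * D / (volume Y).toReal⌋₊ ≤ ℓ) :
    ∀ z ∈ Set.Icc (-D) D, ∃ y : Fin ℓ → ℝ, (∀ i, y i ∈ Y) ∧ ∑ i, y i = z := by
  intro z hz
  have hI : (0 : ℝ) ∈ Set.Icc (-D) D := by simp [hD.le]
  have hreach := exists_mem_reachSet hD hYmeas hYsub hYsym hYpos hz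
  classical
  set k := Nat.find hreach
  have hzk : z ∈ reachSet Y (Set.Icc (-D) D) k := Nat.find_spec hreach
  have hmin : ∀ m < k, z ∉ reachSet Y (Set.Icc (-D) D) m := fun m hm => Nat.find_min hreach hm
  suffices hkℓ : k ≤ ℓ from
    exists_sum_eq_of_mem_reachSet ℓ (monotone_reachSet hI hY0 hkℓ hzk)
  choose! t ht htnew using fun (n : ℕ) (hn : n ≤ k) =>
    exists_mem_reachSet_notMem_lt hI hY0 hzk hmin hn
  have hle : ∀ i ∈ range (k / 3 + 1), 3 * i ≤ k := fun i hi => by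
    rw [mem_range] at hi
    omega
  have hlt : ∀ i j, i < j → 3 * j ≤ k →
      Disjoint ((fun x => t (3 * i) + x) '' Y) ((fun x => t (3 * j) + x) '' Y) := by
    intro i j hij hj
    rw [Set.disjoint_left]
    rintro _ ⟨a, ha, rfl⟩ ⟨b, hb, hab⟩
    have heq : t (3 * j) = t (3 * i) + a + -b := by
      simp only at hab
      linarith
    have hmem := reachSet_subset hI _ (ht (3 * j) hj)
    refine htnew (3 * j) hj (3 * i + 2) (by omega) ?_
    rw [heq] at hmem ⊢
    exact add_add_mem_reachSet hD hYsub (ht (3 * i) (by omega)) ha ((hYsym b).1 hb) hmem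
  have hcard := card_mul_volume_le_of_pairwiseDisjoint hD hYmeas hYsub (range (k / 3 + 1))
    (fun i => t (3 * i)) (fun i hi => reachSet_subset hI _ (ht _ (hle i hi))) (by
      intro i hi j hj hij
      rcases lt_or_gt_of_ne hij with h | h
      · exact hlt i j h (hle j hj)
      · exact (hlt j i h (hle i hi)).symm)
  have hfin : volume Y ≠ ⊤ := measure_ne_top_of_subset hYsub (by simp)
  have hpos : 0 < (volume Y).toReal := ENNReal.toReal_pos hYpos.ne' hfin
  refine le_trans (Nat.le_floor ?_) hℓ
  rw [le_div_iff₀ hpos]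
  have h3 : (k : ℝ) ≤ 3 * ((k / 3 + 1 : ℕ) : ℝ) := by
    exact_mod_cast (by omega : k ≤ 3 * (k / 3 + 1))
  rw [card_range] at hcard
  nlinarith
end

section
/- Let B > 0 and K ≥ 0. Let φ : ℝ → ℝ be a bounded function such that |φ(α₁ + α₂) − φ(α₁) − φ(α₂)| ≤ K whenever α₁, α₂ and α₁ + α₂ all lie in [−B, B]. Then, with c := φ(B)/B, one has |φ(α) − c·α| ≤ 3K for every α ∈ [−B, B]. -/
/-- An approximately additive function on `[-B, B]` with defect `K` that is bounded and vanishes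
at `B` is bounded by `2 * K` on `[0, B]`. -/
theorem abs_le_two_mul_of_approx_additive {B K M : ℝ} {ψ : ℝ → ℝ} (hB : 0 < B) (hK : 0 ≤ K)
    (hM : ∀ x ∈ Set.Icc 0 B, |ψ x| ≤ M) (hψB : ψ B = 0)
    (hψ : ∀ x y : ℝ, x ∈ Set.Icc (-B) B → y ∈ Set.Icc (-B) B →
      x + y ∈ Set.Icc (-B) B → |ψ (x + y) - ψ x - ψ y| ≤ K) :
    ∀ x ∈ Set.Icc 0 B, |ψ x| ≤ 2 * K := by
  have halving : ∀ n : ℕ, ∀ x ∈ Set.Icc 0 B, |ψ x| ≤ 2 * K + M * (1 / 2) ^ n := by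
    intro n
    induction n with
    | zero =>
      intro x hx
      have := hM x hx
      simp only [pow_zero, mul_one]
      linarith
    | succ n ih =>
      rintro x ⟨hx0, hxB⟩
      rw [pow_succ]
      rcases le_total (x + x) B with h | h
      · have h1 := abs_le.1 (ih (x + x) ⟨by linarith, h⟩)
        have h2 := abs_le.1 (hψ x x ⟨by linarith, hxB⟩ ⟨by linarith, hxB⟩ ⟨by linarith, h⟩)
        rw [abs_le]
        constructor <;> linarith
      · have h1 := abs_le.1 (ih (x + (x - B)) ⟨by linarith, by linarith⟩)
        have h2 := abs_le.1 (hψ x (x - B) ⟨by linarith, hxB⟩ ⟨by linarith, by linarith⟩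
          ⟨by linarith, by linarith⟩)
        have h3 := hψ B (x - B) ⟨by linarith, le_rfl⟩ ⟨by linarith, by linarith⟩
          ⟨by linarith, by linarith⟩
        rw [add_sub_cancel, hψB] at h3
        have h3 := abs_le.1 h3
        rw [abs_le]
        constructor <;> linarith
  intro x hx
  have hlim : Filter.Tendsto (fun n : ℕ => 2 * K + M * (1 / 2 : ℝ) ^ n) Filter.atTop
      (nhds (2 * K + M * 0)) :=
    ((tendsto_pow_atTop_nhds_zero_of_lt_one (by norm_num) (by norm_num)).const_mul M).const_add _
  rw [mul_zero, add_zero] at hlim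
  exact ge_of_tendsto' hlim fun n => halving n x hx


/-- **Lemma 3.6 (approximate Cauchy functional equation).** If `φ : ℝ → ℝ` is bounded and
`|φ(α₁+α₂) - φ(α₁) - φ(α₂)| ≤ K` whenever `α₁, α₂, α₁+α₂ ∈ [-B, B]`, then with
`c = φ(B)/B` we have `|φ(α) - cα| ≤ 3K` for all `α ∈ [-B, B]`. -/
theorem approximate_cauchy_functional_equation
    (B K : ℝ) (hB : 0 < B) (hK : 0 ≤ K)
    (φ : ℝ → ℝ) (hbdd : ∃ M : ℝ, ∀ t : ℝ, |φ t| ≤ M)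
    (hφ : ∀ α₁ α₂ : ℝ, α₁ ∈ Set.Icc (-B) B → α₂ ∈ Set.Icc (-B) B →
      α₁ + α₂ ∈ Set.Icc (-B) B → |φ (α₁ + α₂) - φ α₁ - φ α₂| ≤ K) :
    ∀ α ∈ Set.Icc (-B) B, |φ α - (φ B / B) * α| ≤ 3 * K := by
  obtain ⟨M, hM⟩ := hbdd
  set c := φ B / B with hc
  have hcB : φ B - c * B = 0 := by rw [hc, div_mul_cancel₀ _ hB.ne', sub_self]
  have hψ : ∀ x y : ℝ, x ∈ Set.Icc (-B) B → y ∈ Set.Icc (-B) B → x + y ∈ Set.Icc (-B) B →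
      |(φ (x + y) - c * (x + y)) - (φ x - c * x) - (φ y - c * y)| ≤ K := by
    intro x y hx hy hxy
    convert hφ x y hx hy hxy using 2
    ring
  have hbound : ∀ x ∈ Set.Icc 0 B, |φ x - c * x| ≤ M + |c| * B := by
    rintro x ⟨hx0, hxB⟩
    calc |φ x - c * x| ≤ |φ x| + |c * x| := abs_sub _ _
      _ ≤ M + |c| * B := by
        rw [abs_mul, abs_of_nonneg hx0]
        gcongr
        exact hM x
  have key := abs_le_two_mul_of_approx_additive (ψ := fun x => φ x - c * x) hB hK hbound hcB hψ
  rintro α ⟨hα, hαB⟩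
  rcases le_total 0 α with h | h
  · exact (key α ⟨h, hαB⟩).trans (by linarith)
  · have h1 := abs_le.1 (key (B + α) ⟨by linarith, by linarith⟩)
    have h2 := hψ B α ⟨by linarith, le_rfl⟩ ⟨hα, hαB⟩ ⟨by linarith, by linarith⟩
    rw [hcB] at h2
    have h2 := abs_le.1 h2
    rw [abs_le]
    constructor <;> linarith
end

section
/- Let P be a set of odd primes with ∑_{p ∈ P} 1/p < ∞. Then there exists a constant c > 0 (depending on P) such that |{n ≤ x : n is odd, n and n+2 are both squarefree, and no prime p ∈ P divides n(n+2)}| = (c + o(1))·x as x → ∞. In particular, this set has positive natural density. -/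
open Finset Filter
open scoped Classical

/-- A predicate with period `M` holds for a proportion `M.count p / M` of the integers below `N`,
up to an error of at most `M`. -/
theorem abs_count_sub_le_of_periodic {p : ℕ → Prop} {M : ℕ} (hM : 0 < M)
    (hp : Function.Periodic p M) (N : ℕ) :
    |(Nat.count p N : ℝ) - N * (Nat.count p M / M : ℝ)| ≤ M := by
  have key : ∀ q r : ℕ, Nat.count p (M * q + r) = q * Nat.count p M + Nat.count p r := by
    intro q r
    induction q with
    | zero => simp
    | succ q ih =>
      have hs : (fun k => p (M + k)) = p := funext fun k => by rw [add_comm]; exact hp k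
      rw [show M * (q + 1) + r = M + (M * q + r) by ring, Nat.count_add]
      simp only [hs]
      rw [ih]
      ring
  have hN := Nat.div_add_mod N M
  have hlt := Nat.mod_lt N hM
  set q := N / M
  set r := N % M
  have hM' : (0 : ℝ) < M := by exact_mod_cast hM
  have hcr : (Nat.count p r : ℝ) ≤ r := by exact_mod_cast Nat.count_le _
  have hcM : (Nat.count p M : ℝ) ≤ M := by exact_mod_cast Nat.count_le _
  have hrM : (r : ℝ) ≤ M := by exact_mod_cast hlt.le
  have hd1 : (Nat.count p M / M : ℝ) ≤ 1 := (div_le_one hM').2 hcM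
  have hd0 : (0 : ℝ) ≤ (Nat.count p M / M : ℝ) := by positivity
  have hr0 : (0 : ℝ) ≤ r := by positivity
  have hc0 : (0 : ℝ) ≤ Nat.count p r := by positivity
  have e : (Nat.count p N : ℝ) - N * (Nat.count p M / M : ℝ)
      = Nat.count p r - r * (Nat.count p M / M : ℝ) := by
    rw [← hN, key]
    push_cast
    field_simp
    ring
  rw [e, abs_le]
  constructor <;> nlinarith

theorem tendsto_count_div_of_periodic {p : ℕ → Prop} {M : ℕ} (hM : 0 < M)
    (hp : Function.Periodic p M) :
    Tendsto (fun N : ℕ => (Nat.count p N : ℝ) / N) atTop (nhds (Nat.count p M / M : ℝ)) := by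
  rw [tendsto_iff_norm_sub_tendsto_zero]
  refine squeeze_zero' (Eventually.of_forall fun _ => norm_nonneg _) ?_
    (tendsto_const_div_atTop_nhds_zero_nat (M : ℝ))
  filter_upwards [eventually_gt_atTop 0] with N hN
  have hN' : (0 : ℝ) < N := by exact_mod_cast hN
  have := abs_count_sub_le_of_periodic hM hp N
  rw [Real.norm_eq_abs, le_div_iff₀ hN', ← abs_of_pos hN', ← abs_mul, sub_mul,
    abs_of_pos hN', div_mul_cancel₀ _ hN'.ne', mul_comm _ (N : ℝ)]
  exact this

theorem card_le_of_modEq {a b : ℕ} {S : Finset ℕ} (hlt : ∀ k ∈ S, k < a * b)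
    (hmod : ∀ k ∈ S, ∀ l ∈ S, k ≡ l [MOD a]) : #S ≤ b := by
  rw [← Finset.card_range b]
  refine Finset.card_le_card_of_injOn (fun k => k / a) ?_ ?_
  · intro k hk
    simpa using Nat.div_lt_of_lt_mul (hlt k hk)
  · intro k hk l hl h
    rw [← Nat.div_add_mod k a, ← Nat.div_add_mod l a, hmod k hk l hl]
    simp only at h
    rw [h]

theorem le_card_filter_dvd_add_two {M : ℕ} (hM : 0 < M) (b : ℕ) :
    b ≤ #{k ∈ range (M * b) | M ∣ k + 2} := by
  obtain ⟨v, hv, hd⟩ : ∃ v < M, M ∣ v + 2 := by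
    rcases Nat.lt_or_ge M 2 with h | h
    · obtain rfl : M = 1 := by omega
      exact ⟨0, one_pos, one_dvd _⟩
    · exact ⟨M - 2, by omega, by rw [Nat.sub_add_cancel h]⟩
  conv_lhs => rw [← Finset.card_range b]
  refine Finset.card_le_card_of_injOn (fun j => M * j + v) ?_ ?_
  · intro j hj
    have hj : j + 1 ≤ b := by simpa using hj
    have := Nat.mul_le_mul_left M hj
    simp only [coe_filter, Finset.mem_range, Set.mem_ofPred_eq]
    refine ⟨by linarith, ?_⟩
    rw [add_assoc]
    exact (Dvd.intro j rfl).add hd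
  · intro j _ l _ h
    simpa [hM.ne'] using h

section Sieve

variable {ι : Type*} {m : ι → ℕ}

/-- `k + 1` survives the sieve by the moduli in `s`: none of them divides `k + 1` or `k + 3`. -/
def Survives (m : ι → ℕ) (s : Set ι) (k : ℕ) : Prop :=
  ∀ i ∈ s, ¬ m i ∣ k + 1 ∧ ¬ m i ∣ k + 3

theorem survives_periodic (m : ι → ℕ) (s : Finset ι) :
    Function.Periodic (Survives m s) (∏ i ∈ s, m i) := by
  intro k
  refine propext (forall₂_congr fun i hi => ?_)
  have hd : m i ∣ ∏ i ∈ s, m i := Finset.dvd_prod_of_mem m hi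
  rw [add_right_comm, Nat.dvd_add_left hd, add_right_comm, Nat.dvd_add_left hd]

theorem count_survives_le (h2 : ∀ i, 2 ≤ m i) (hsum : Summable fun i => (m i : ℝ)⁻¹)
    {s : Finset ι} {ε : ℝ} (hs : ∀ t : Finset ι, Disjoint t s → ∑ i ∈ t, (m i : ℝ)⁻¹ ≤ ε)
    (N : ℕ) :
    (Nat.count (Survives m s) N : ℝ) ≤ Nat.count (Survives m Set.univ) N + (2 * N + 2) * ε := by
  have hfin : {i | m i ≤ N + 2}.Finite := by
    have := hsum.tendsto_cofinite_zero.eventually_lt_const (u := ((N : ℝ) + 2)⁻¹) (by positivity)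
    refine (Filter.eventually_cofinite.1 this).subset fun i hi => ?_
    have hi : m i ≤ N + 2 := hi
    have h0 : (0 : ℝ) < m i := by exact_mod_cast (by linarith [h2 i] : 0 < m i)
    simp only [Set.mem_ofPred_eq, not_lt]
    exact inv_anti₀ h0 (by exact_mod_cast hi)
  set t := hfin.toFinset \ s
  have hsub : {k ∈ range N | Survives m s k} ⊆ {k ∈ range N | Survives m Set.univ k} ∪
      t.biUnion fun i => {k ∈ range N | m i ∣ k + 1} ∪ {k ∈ range N | m i ∣ k + 3} := by
    intro k hk
    simp only [Finset.mem_filter, Finset.mem_range] at hk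
    by_cases hk' : Survives m Set.univ k
    · simp [hk.1, hk']
    · simp only [Survives, Set.mem_univ, true_imp_iff, not_forall, not_and_or, not_not] at hk'
      obtain ⟨i, hi⟩ := hk'
      have his : i ∉ s := fun h => by
        have := hk.2 i h
        tauto
      have hle : m i ≤ N + 2 := by
        rcases hi with h | h
        · have := Nat.le_of_dvd (by omega) h
          omega
        · have := Nat.le_of_dvd (by omega) h
          omega
      refine Finset.mem_union_right _ (Finset.mem_biUnion.2 ⟨i, ?_, ?_⟩)
      · simp [t, hle, his]
      · simpa [hk.1] using hi
  have h3 : ∀ i, #{k ∈ range N | m i ∣ k + 3} ≤ (N + 2) / m i := fun i => by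
    rw [← Nat.card_multiples]
    refine Finset.card_le_card_of_injOn (fun k => k + 2) ?_ fun a _ b _ h => by simpa using h
    intro k hk
    simpa using hk
  have hterm : ∀ i, (#({k ∈ range N | m i ∣ k + 1} ∪ {k ∈ range N | m i ∣ k + 3}) : ℝ) ≤
      (2 * N + 2) * (m i : ℝ)⁻¹ := fun i => by
    have hA := (Finset.card_union_le {k ∈ range N | m i ∣ k + 1} {k ∈ range N | m i ∣ k + 3}).trans
      (Nat.add_le_add (Nat.card_multiples N (m i)).le (h3 i))
    have hB : ((N / m i : ℕ) : ℝ) ≤ N / m i := Nat.cast_div_le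
    have hC : (((N + 2) / m i : ℕ) : ℝ) ≤ (N + 2 : ℕ) / m i := Nat.cast_div_le
    refine (Nat.cast_le.2 hA).trans ?_
    push_cast at hC ⊢
    refine (add_le_add hB hC).trans (le_of_eq ?_)
    rw [div_eq_mul_inv, div_eq_mul_inv]
    ring
  rw [Nat.count_eq_card_filter_range, Nat.count_eq_card_filter_range]
  have h4 := (Finset.card_le_card hsub).trans ((Finset.card_union_le _ _).trans
    (Nat.add_le_add_left Finset.card_biUnion_le _))
  refine (Nat.cast_le.2 h4).trans ?_
  push_cast
  gcongr
  refine (Finset.sum_le_sum fun i _ => hterm i).trans ?_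
  rw [← Finset.mul_sum]
  gcongr
  exact hs t Finset.sdiff_disjoint

theorem count_survives_union_ge (h2 : ∀ i, 2 ≤ m i)
    (hcop : Pairwise fun i j => (m i).Coprime (m j))
    {s t : Finset ι} (hst : Disjoint t s) (ht : ∑ i ∈ t, (m i : ℝ)⁻¹ ≤ 1 / 4) :
    1 / (2 * (∏ i ∈ s, m i : ℕ) : ℝ) ≤
      (Nat.count (Survives m ↑(s ∪ t)) (∏ i ∈ s ∪ t, m i) : ℝ) / (∏ i ∈ s ∪ t, m i : ℕ) := by
  have hpos : ∀ u : Finset ι, 0 < ∏ i ∈ u, m i :=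
    fun u => Finset.prod_pos fun i _ => by linarith [h2 i]
  rw [Finset.prod_union hst.symm]
  have hM := hpos s
  have hM' := hpos t
  have hdvd : ∀ i ∈ t, m i ∣ ∏ i ∈ t, m i := fun i hi => Finset.dvd_prod_of_mem m hi
  have hdvds : ∀ i ∈ s, m i ∣ ∏ i ∈ s, m i := fun i hi => Finset.dvd_prod_of_mem m hi
  have hcopM : ∀ i ∈ t, (∏ i ∈ s, m i).Coprime (m i) := fun i hi =>
    Nat.Coprime.prod_left fun j hj => hcop fun h => Finset.disjoint_left.1 hst hi (h ▸ hj)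
  set M := ∏ i ∈ s, m i
  set M' := ∏ i ∈ t, m i
  have hbad : ∀ i ∈ t, ∀ a : ℕ,
      (#{k ∈ range (M * M') | M ∣ k + 2 ∧ m i ∣ k + a} : ℝ) ≤ M' * (m i : ℝ)⁻¹ := by
    intro i hi a
    have hc : #{k ∈ range (M * M') | M ∣ k + 2 ∧ m i ∣ k + a} ≤ M' / m i := by
      refine card_le_of_modEq (a := M * m i) ?_ ?_
      · intro k hk
        rw [mul_assoc, Nat.mul_div_cancel' (hdvd i hi)]
        simpa using (Finset.mem_filter.1 hk).1
      · intro k hk l hl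
        simp only [Finset.mem_filter] at hk hl
        refine (Nat.modEq_and_modEq_iff_modEq_mul (hcopM i hi)).1 ⟨?_, ?_⟩
        · exact Nat.ModEq.add_right_cancel' 2 (((Nat.modEq_zero_iff_dvd).2 hk.2.1).trans
            ((Nat.modEq_zero_iff_dvd).2 hl.2.1).symm)
        · exact Nat.ModEq.add_right_cancel' a (((Nat.modEq_zero_iff_dvd).2 hk.2.2).trans
            ((Nat.modEq_zero_iff_dvd).2 hl.2.2).symm)
    rw [← div_eq_mul_inv]
    exact (Nat.cast_le.2 hc).trans Nat.cast_div_le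
  have hsub : {k ∈ range (M * M') | M ∣ k + 2} ⊆
      {k ∈ range (M * M') | Survives m ↑(s ∪ t) k} ∪
      t.biUnion fun i => {k ∈ range (M * M') | M ∣ k + 2 ∧ m i ∣ k + 1} ∪
        {k ∈ range (M * M') | M ∣ k + 2 ∧ m i ∣ k + 3} := by
    intro k hk
    simp only [Finset.mem_filter, Finset.mem_range] at hk
    by_cases hk' : Survives m ↑(s ∪ t) k
    · exact Finset.mem_union_left _
        (by simpa only [Finset.mem_filter, Finset.mem_range] using ⟨hk.1, hk'⟩)
    · simp only [Survives, not_forall, not_and_or, not_not, Finset.coe_union, Set.mem_union,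
        Finset.mem_coe] at hk'
      obtain ⟨i, hi, hik⟩ := hk'
      have hit : i ∈ t := by
        refine hi.resolve_left fun his => ?_
        have hd : m i ∣ k + 2 := (hdvds i his).trans hk.2
        have h1 : m i ∣ 1 := by
          rcases hik with h | h
          · exact (Nat.dvd_add_right h).1 hd
          · exact (Nat.dvd_add_right hd).1 h
        have := Nat.le_of_dvd one_pos h1
        linarith [h2 i]
      refine Finset.mem_union_right _ (Finset.mem_biUnion.2 ⟨i, hit, ?_⟩)
      simpa [hk.1, hk.2] using hik
  have h4 := (le_card_filter_dvd_add_two hM M').trans ((Finset.card_le_card hsub).trans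
    ((Finset.card_union_le _ _).trans (Nat.add_le_add_left Finset.card_biUnion_le _)))
  rw [← Nat.count_eq_card_filter_range] at h4
  have h5 : (M' : ℝ) ≤ Nat.count (Survives m ↑(s ∪ t)) (M * M') + ∑ i ∈ t,
      (#({k ∈ range (M * M') | M ∣ k + 2 ∧ m i ∣ k + 1} ∪
        {k ∈ range (M * M') | M ∣ k + 2 ∧ m i ∣ k + 3}) : ℝ) := by exact_mod_cast h4
  have h6 : ∑ i ∈ t, (#({k ∈ range (M * M') | M ∣ k + 2 ∧ m i ∣ k + 1} ∪
        {k ∈ range (M * M') | M ∣ k + 2 ∧ m i ∣ k + 3}) : ℝ) ≤ 2 * M' * (1 / 4) := by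
    refine (Finset.sum_le_sum (g := fun i => 2 * M' * (m i : ℝ)⁻¹) fun i hi => ?_).trans ?_
    · have hu := Finset.card_union_le {k ∈ range (M * M') | M ∣ k + 2 ∧ m i ∣ k + 1}
        {k ∈ range (M * M') | M ∣ k + 2 ∧ m i ∣ k + 3}
      refine (Nat.cast_le.2 hu).trans ?_
      push_cast
      linarith [hbad i hi 1, hbad i hi 3]
    · rw [← Finset.mul_sum]
      gcongr
  have hMr : (0 : ℝ) < M := by exact_mod_cast hM
  have hMr' : (0 : ℝ) < M' := by exact_mod_cast hM'
  rw [Nat.cast_mul, div_le_div_iff₀ (by positivity) (by positivity)]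
  nlinarith

theorem exists_pos_tendsto_count_survives (h2 : ∀ i, 2 ≤ m i)
    (hcop : Pairwise fun i j => (m i).Coprime (m j)) (hsum : Summable fun i => (m i : ℝ)⁻¹) :
    ∃ c : ℝ, 0 < c ∧
      Tendsto (fun N : ℕ => (Nat.count (Survives m Set.univ) N : ℝ) / N) atTop (nhds c) := by
  set a : ℕ → ℝ := fun N => (Nat.count (Survives m Set.univ) N : ℝ) / N
  set d : Finset ι → ℝ := fun s => (Nat.count (Survives m s) (∏ i ∈ s, m i) : ℝ) /
    (∏ i ∈ s, m i : ℕ)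
  have hd : ∀ s : Finset ι,
      Tendsto (fun N : ℕ => (Nat.count (Survives m s) N : ℝ) / N) atTop (nhds (d s)) := fun s =>
    tendsto_count_div_of_periodic (Finset.prod_pos fun i _ => by linarith [h2 i])
      (survives_periodic m s)
  have htail : ∀ ε > 0, ∃ s : Finset ι, ∀ t : Finset ι, Disjoint t s →
      ∑ i ∈ t, (m i : ℝ)⁻¹ ≤ ε := by
    intro ε hε
    obtain ⟨s, hs⟩ := summable_iff_vanishing_norm.1 hsum ε hε
    exact ⟨s, fun t ht => (le_abs_self _).trans (hs t ht).le⟩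
  have hnear : ∀ ε > 0, ∀ s : Finset ι,
      (∀ t : Finset ι, Disjoint t s → ∑ i ∈ t, (m i : ℝ)⁻¹ ≤ ε) →
      ∀ᶠ N in atTop, |a N - d s| ≤ 5 * ε := by
    intro ε hε s hs
    filter_upwards [(Metric.tendsto_nhds.1 (hd s)) ε hε, eventually_gt_atTop 0] with N hN hN0
    have hN1 : (1 : ℝ) ≤ N := by exact_mod_cast hN0
    rw [Real.dist_eq, abs_lt] at hN
    have hle : a N ≤ (Nat.count (Survives m s) N : ℝ) / N := by
      refine div_le_div_of_nonneg_right (Nat.cast_le.2 ?_) N.cast_nonneg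
      exact Nat.count_mono_left fun k _ hk i _ => hk i trivial
    have hge : (Nat.count (Survives m s) N : ℝ) / N ≤ a N + 4 * ε := by
      simp only [a]
      rw [div_add' _ _ _ (by positivity)]
      gcongr
      refine (count_survives_le h2 hsum hs N).trans ?_
      nlinarith
    rw [abs_le]
    constructor <;> linarith
  obtain ⟨c, hc⟩ : ∃ c, Tendsto a atTop (nhds c) := by
    refine cauchySeq_tendsto_of_complete (Metric.cauchySeq_iff'.2 fun ε hε => ?_)
    obtain ⟨s, hs⟩ := htail (ε / 11) (by positivity)
    obtain ⟨N, hN⟩ := eventually_atTop.1 (hnear (ε / 11) (by positivity) s hs)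
    refine ⟨N, fun n hn => ?_⟩
    have h1 := abs_le.1 (hN n hn)
    have h2 := abs_le.1 (hN N le_rfl)
    rw [Real.dist_eq, abs_lt]
    constructor <;> linarith
  refine ⟨c, ?_, hc⟩
  obtain ⟨s, hs⟩ := htail (1 / 4) (by norm_num)
  have hδ : (0 : ℝ) < 1 / (2 * (∏ i ∈ s, m i : ℕ) : ℝ) := by
    have : 0 < ∏ i ∈ s, m i := Finset.prod_pos fun i _ => by linarith [h2 i]
    positivity
  set δ := 1 / (2 * (∏ i ∈ s, m i : ℕ) : ℝ)
  obtain ⟨u, hu⟩ := htail (δ / 10) (by positivity)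
  have hlow : δ ≤ d (s ∪ (u \ s)) :=
    count_survives_union_ge h2 hcop Finset.sdiff_disjoint (hs _ Finset.sdiff_disjoint)
  have hev := hnear (δ / 10) (by positivity) (s ∪ (u \ s)) fun t ht => hu t <|
    ht.mono_right fun i hi => by simp only [Finset.mem_union, Finset.mem_sdiff]; tauto
  have : δ / 2 ≤ c := ge_of_tendsto hc (hev.mono fun N hN => by
    have := abs_le.1 hN
    linarith)
  linarith

end Sieve

/-- The modulus whose multiples are sieved out at the prime `p`. -/
noncomputable def sieveModulus (P : Set ℕ) (p : Nat.Primes) : ℕ :=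
  if (p : ℕ) = 2 ∨ (p : ℕ) ∈ P then p else p ^ 2

theorem two_le_sieveModulus (P : Set ℕ) (p : Nat.Primes) : 2 ≤ sieveModulus P p := by
  have := p.2.two_le
  unfold sieveModulus
  split_ifs <;> nlinarith

theorem sieveModulus_coprime (P : Set ℕ) :
    Pairwise fun p q => (sieveModulus P p).Coprime (sieveModulus P q) := by
  intro p q hpq
  have h : Nat.Coprime p q := (Nat.coprime_primes p.2 q.2).2 fun h => hpq (Subtype.ext h)
  simp only [sieveModulus]
  split_ifs
  · exact h
  · exact h.pow_right 2
  · exact h.pow_left 2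
  · exact h.pow 2 2

theorem summable_inv_sieveModulus {P : Set ℕ}
    (hconv : Summable (fun p : ℕ => if p ∈ P then (p : ℝ)⁻¹ else 0)) :
    Summable fun p => (sieveModulus P p : ℝ)⁻¹ := by
  have h2 : Summable fun n : ℕ => if n = 2 then (1 : ℝ) else 0 :=
    (hasSum_ite_eq 2 (1 : ℝ)).summable
  have hsq : Summable fun n : ℕ => ((n : ℝ) ^ 2)⁻¹ := Real.summable_nat_pow_inv.2 one_lt_two
  have hs := ((h2.add hconv).add hsq).comp_injective
    (Subtype.val_injective : Function.Injective ((↑) : Nat.Primes → ℕ))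
  refine Summable.of_nonneg_of_le (fun p => by positivity) (fun p => ?_) hs
  have hp : (1 : ℝ) ≤ (p : ℕ) := by exact_mod_cast p.2.one_lt.le
  have hinv : ((p : ℕ) : ℝ)⁻¹ ≤ 1 := inv_le_one_of_one_le₀ hp
  have h0 : (0 : ℝ) ≤ (((p : ℕ) : ℝ) ^ 2)⁻¹ := by positivity
  have h1 : (0 : ℝ) ≤ ((p : ℕ) : ℝ)⁻¹ := by positivity
  change _ ≤ (if (p : ℕ) = 2 then (1 : ℝ) else 0) +
    (if (p : ℕ) ∈ P then ((p : ℕ) : ℝ)⁻¹ else 0) + (((p : ℕ) : ℝ) ^ 2)⁻¹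
  simp only [sieveModulus]
  split_ifs <;> first | (push_cast; linarith) | (exfalso; tauto)

theorem survives_sieveModulus_iff {P : Set ℕ} (hP : ∀ p ∈ P, Nat.Prime p ∧ Odd p) (k : ℕ) :
    Survives (sieveModulus P) Set.univ k ↔
      Odd (k + 1) ∧ Squarefree (k + 1) ∧ Squarefree (k + 1 + 2) ∧
        ∀ p ∈ P, ¬ p ∣ (k + 1) * (k + 1 + 2) := by
  have hdvd : ∀ p : Nat.Primes, sieveModulus P p ∣ (p : ℕ) * p := fun p => by
    unfold sieveModulus
    split_ifs
    · exact dvd_mul_right _ _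
    · rw [sq]
  constructor
  · intro h
    have h2 : ¬ 2 ∣ k + 1 := by
      have := (h ⟨2, Nat.prime_two⟩ trivial).1
      simpa [sieveModulus] using this
    refine ⟨by rwa [← Nat.not_even_iff_odd, even_iff_two_dvd], ?_, ?_, fun p hp hd => ?_⟩
    · exact Nat.squarefree_iff_prime_squarefree.2 fun p hp hd =>
        (h ⟨p, hp⟩ trivial).1 ((hdvd ⟨p, hp⟩).trans hd)
    · exact Nat.squarefree_iff_prime_squarefree.2 fun p hp hd =>
        (h ⟨p, hp⟩ trivial).2 ((hdvd ⟨p, hp⟩).trans hd)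
    · have hs := h ⟨p, (hP p hp).1⟩ trivial
      simp only [sieveModulus, hp, or_true, if_true] at hs
      exact ((hP p hp).1.dvd_mul.1 hd).elim hs.1 hs.2
  · rintro ⟨hodd, hsq, hsq', hPn⟩ p -
    rw [← Nat.not_even_iff_odd, even_iff_two_dvd] at hodd
    by_cases hp2 : (p : ℕ) = 2
    · simp only [sieveModulus, hp2, true_or, if_true]
      omega
    by_cases hpP : (p : ℕ) ∈ P
    · simp only [sieveModulus, hpP, or_true, if_true]
      have := hPn p hpP
      exact ⟨fun h => this (h.mul_right _), fun h => this (Dvd.dvd.mul_left h _)⟩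
    · simp only [sieveModulus, hpP, hp2, or_self, if_false, sq]
      exact ⟨Nat.squarefree_iff_prime_squarefree.1 hsq p p.2,
        Nat.squarefree_iff_prime_squarefree.1 hsq' p p.2⟩

/-- **(Section 4, sieve step in the proof of Proposition 1.2.)** If `P` is a set of odd
primes with `∑_{p ∈ P} 1/p < ∞`, then the set of odd `n` such that `n` and `n+2` are both
squarefree and no prime of `P` divides `n(n+2)` has natural density `c > 0`. -/
theorem sieve_positive_density
    (P : Set ℕ) (hP : ∀ p ∈ P, Nat.Prime p ∧ Odd p)
    (hconv : Summable (fun p : ℕ => if p ∈ P then (p : ℝ)⁻¹ else 0)) :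
    ∃ c : ℝ, 0 < c ∧
      Tendsto (fun x : ℝ =>
          (((Finset.Icc 1 ⌊x⌋₊).filter (fun n : ℕ =>
              Odd n ∧ Squarefree n ∧ Squarefree (n + 2) ∧
                ∀ p ∈ P, ¬ p ∣ n * (n + 2))).card : ℝ) / x)
        atTop (nhds c) := by
  obtain ⟨c, hc, hlim⟩ := exists_pos_tendsto_count_survives (two_le_sieveModulus P)
    (sieveModulus_coprime P) (summable_inv_sieveModulus hconv)
  refine ⟨c, hc, ?_⟩
  have hcard : ∀ N : ℕ, #((Finset.Icc 1 N).filter (fun n : ℕ =>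
      Odd n ∧ Squarefree n ∧ Squarefree (n + 2) ∧ ∀ p ∈ P, ¬ p ∣ n * (n + 2))) =
      Nat.count (Survives (sieveModulus P) Set.univ) N := by
    intro N
    rw [Nat.count_eq_card_filter_range]
    refine (Finset.card_nbij' (· + 1) (· - 1) ?_ ?_ ?_ ?_).symm
    · intro k hk
      simp only [coe_filter, Finset.mem_range, Set.mem_ofPred_eq, Finset.mem_Icc] at hk ⊢
      exact ⟨by omega, (survives_sieveModulus_iff hP k).1 hk.2⟩
    · intro n hn
      simp only [coe_filter, Finset.mem_range, Set.mem_ofPred_eq, Finset.mem_Icc] at hn ⊢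
      refine ⟨by omega, (survives_sieveModulus_iff hP _).2 ?_⟩
      rw [Nat.sub_add_cancel hn.1.1]
      exact hn.2
    · intro k _
      simp
    · intro n hn
      simp only [coe_filter, Set.mem_ofPred_eq, Finset.mem_Icc] at hn
      exact Nat.sub_add_cancel hn.1.1
  simp only [hcard]
  have hprod := (hlim.comp (tendsto_nat_floor_atTop (α := ℝ))).mul
    (tendsto_nat_floor_div_atTop (R := ℝ))
  rw [mul_one] at hprod
  refine hprod.congr' ?_
  filter_upwards [eventually_ge_atTop 1] with x hx
  have hfl : (0 : ℝ) < ⌊x⌋₊ := by exact_mod_cast Nat.floor_pos.2 hx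
  simp only [Function.comp_apply]
  field_simp
end
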